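/- Let x̄ ∈ Ω. Then the singular subdifferential satisfies ∂^∞ T(x̄) ⊆ N(x̄; Ω) ∩ F*_+, where F*_+ := {x* ∈ X* : ⟨x*, v⟩ ≥ 0 for all v ∈ F} is the positive dual cone of the dynamics. Moreover, this inclusion holds as equality when 0 ∈ F and the support function σ_F is sequentially weak* continuous on the set −[N(x̄; Ω) ∩ F*_+]. -/

import Mathlib

open Set Filter Topology Pointwise
open scoped ENNReal

variable {X : Type*}

/-- Minimal time function `T(x) = inf{t ≥ 0 : Ω ∩ (x + tF) ≠ ∅}`, with `inf ∅ = ∞`. -/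
noncomputable def mtime [NormedAddCommGroup X] [NormedSpace ℝ X]
    (Ω F : Set X) (x : X) : ℝ≥0∞ :=
  ⨅ (t : ℝ) (_ : 0 ≤ t ∧ ∃ q ∈ F, x + t • q ∈ Ω), ENNReal.ofReal t

/-- Minkowski gauge `ρ_F(u) = inf{t ≥ 0 : u ∈ tF}`, with `inf ∅ = ∞`. -/
noncomputable def mgauge [NormedAddCommGroup X] [NormedSpace ℝ X]
    (F : Set X) (u : X) : ℝ≥0∞ :=
  ⨅ (t : ℝ) (_ : 0 ≤ t ∧ ∃ q ∈ F, u = t • q), ENNReal.ofReal t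

/-- Enlargement `Ω_r = {x : T(x) ≤ r}` of the target set. -/
noncomputable def enl [NormedAddCommGroup X] [NormedSpace ℝ X]
    (Ω F : Set X) (r : ℝ) : Set X :=
  {x | mtime Ω F x ≤ ENNReal.ofReal r}

/-- Generalized (minimal time) projection `Π(x) = (x + T(x)·F) ∩ Ω`. -/
noncomputable def mproj [NormedAddCommGroup X] [NormedSpace ℝ X]
    (Ω F : Set X) (x : X) : Set X :=
  {w | w ∈ Ω ∧ ∃ q ∈ F, w = x + (mtime Ω F x).toReal • q}

/-- Support function `σ_F(x*) = sup_{q ∈ F} ⟨x*, q⟩`. -/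
noncomputable def suppFn [NormedAddCommGroup X] [NormedSpace ℝ X]
    (F : Set X) (p : X →L[ℝ] ℝ) : ℝ :=
  sSup ((fun q => p q) '' F)

/-- Dynamics bound `‖F‖ = sup{‖q‖ : q ∈ F}`. -/
noncomputable def dynBound [NormedAddCommGroup X] (F : Set X) : ℝ :=
  sSup ((fun q => ‖q‖) '' F)

/-- Fréchet `ε`-subdifferential of `φ` at `xb`:
`liminf_{x→xb} (φ(x) − φ(xb) − ⟨x*, x−xb⟩)/‖x−xb‖ ≥ −ε`. -/
def fsub [NormedAddCommGroup X] [NormedSpace ℝ X]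
    (φ : X → ℝ≥0∞) (ε : ℝ) (xb : X) : Set (X →L[ℝ] ℝ) :=
  {p | ∀ γ > (0:ℝ), ∃ δ > (0:ℝ), ∀ x, ‖x - xb‖ < δ →
    ENNReal.ofReal ((φ xb).toReal + p (x - xb) - (ε + γ) * ‖x - xb‖) ≤ φ x}

/-- Set of `ε`-normals to `Θ` at `xb ∈ Θ`. -/
def enormal [NormedAddCommGroup X] [NormedSpace ℝ X]
    (Θ : Set X) (ε : ℝ) (xb : X) : Set (X →L[ℝ] ℝ) :=
  {p | ∀ γ > (0:ℝ), ∃ δ > (0:ℝ), ∀ x ∈ Θ, ‖x - xb‖ < δ →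
    p (x - xb) ≤ (ε + γ) * ‖x - xb‖}

/-- Basic (limiting/Mordukhovich) normal cone. -/
def bnormal [NormedAddCommGroup X] [NormedSpace ℝ X]
    (Θ : Set X) (xb : X) : Set (X →L[ℝ] ℝ) :=
  {p | ∃ (ε : ℕ → ℝ) (x : ℕ → X) (ps : ℕ → X →L[ℝ] ℝ),
    (∀ k, 0 ≤ ε k) ∧ Tendsto ε atTop (𝓝 0) ∧
    (∀ k, x k ∈ Θ) ∧ Tendsto x atTop (𝓝 xb) ∧
    (∀ k, ps k ∈ enormal Θ (ε k) (x k)) ∧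
    (∀ v, Tendsto (fun k => ps k v) atTop (𝓝 (p v)))}

/-- Basic (limiting/Mordukhovich) subdifferential. -/
def bsub [NormedAddCommGroup X] [NormedSpace ℝ X]
    (φ : X → ℝ≥0∞) (xb : X) : Set (X →L[ℝ] ℝ) :=
  {p | ∃ (ε : ℕ → ℝ) (x : ℕ → X) (ps : ℕ → X →L[ℝ] ℝ),
    (∀ k, 0 ≤ ε k) ∧ Tendsto ε atTop (𝓝 0) ∧
    Tendsto x atTop (𝓝 xb) ∧
    Tendsto (fun k => φ (x k)) atTop (𝓝 (φ xb)) ∧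
    (∀ k, ps k ∈ fsub φ (ε k) (x k)) ∧
    (∀ v, Tendsto (fun k => ps k v) atTop (𝓝 (p v)))}

/-- Singular (Mordukhovich) subdifferential. -/
def ssub [NormedAddCommGroup X] [NormedSpace ℝ X]
    (φ : X → ℝ≥0∞) (xb : X) : Set (X →L[ℝ] ℝ) :=
  {p | ∃ (ε lam : ℕ → ℝ) (x : ℕ → X) (ps : ℕ → X →L[ℝ] ℝ),
    (∀ k, 0 ≤ ε k) ∧ Tendsto ε atTop (𝓝 0) ∧
    (∀ k, 0 < lam k) ∧ Tendsto lam atTop (𝓝 0) ∧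
    Tendsto x atTop (𝓝 xb) ∧
    Tendsto (fun k => φ (x k)) atTop (𝓝 (φ xb)) ∧
    (∀ k, ps k ∈ fsub φ (ε k) (x k)) ∧
    (∀ v, Tendsto (fun k => lam k * ps k v) atTop (𝓝 (p v)))}

/-- Subdifferential of convex analysis (for `ℝ≥0∞`-valued convex functions,
finite at the reference point). -/
def csub [NormedAddCommGroup X] [NormedSpace ℝ X]
    (φ : X → ℝ≥0∞) (xb : X) : Set (X →L[ℝ] ℝ) :=
  {p | ∀ x, ENNReal.ofReal (p (x - xb) + (φ xb).toReal) ≤ φ x}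

/-- Normal cone of convex analysis. -/
def cnormal [NormedAddCommGroup X] [NormedSpace ℝ X]
    (Θ : Set X) (xb : X) : Set (X →L[ℝ] ℝ) :=
  {p | ∀ x ∈ Θ, p (x - xb) ≤ 0}

/-- Ekeland's variational principle for a continuous function on a closed set. -/
theorem exists_ekeland {α : Type*} [PseudoMetricSpace α] [CompleteSpace α] {S : Set α}
    (hS : IsClosed S) {g : α → ℝ} (hg : Continuous g) {m : ℝ} (hm : ∀ z ∈ S, m ≤ g z)
    {κ : ℝ} (hκ : 0 < κ) {w : α} (hw : w ∈ S) :
    ∃ u ∈ S, g u + κ * dist u w ≤ g w ∧ ∀ z ∈ S, g u ≤ g z + κ * dist z u := by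
  let A : α → Set α := fun x => {z | z ∈ S ∧ g z + κ * dist z x ≤ g x}
  have self_mem : ∀ x ∈ S, x ∈ A x := fun x hx => ⟨hx, by simp⟩
  have trans_mem : ∀ x y z, y ∈ A x → z ∈ A y → z ∈ A x := fun x y z hy hz =>
    ⟨hz.1, by nlinarith [hy.2, hz.2, dist_triangle z y x]⟩
  have step : ∀ (n : ℕ) (x : S), ∃ y : S, (y : α) ∈ A x ∧
      ∀ z ∈ A x, g y ≤ g z + (1 / 2 : ℝ) ^ n := by
    intro n x
    have hne : (g '' A x).Nonempty := ⟨_, x, self_mem x x.2, rfl⟩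
    have hbd : BddBelow (g '' A x) := ⟨m, by rintro _ ⟨z, hz, rfl⟩; exact hm z hz.1⟩
    obtain ⟨_, ⟨y, hy, rfl⟩, hlt⟩ := exists_lt_of_csInf_lt hne
      (lt_add_of_pos_right (sInf (g '' A x)) (by positivity : (0 : ℝ) < (1 / 2) ^ n))
    exact ⟨⟨y, hy.1⟩, hy, fun z hz => by
      linarith [csInf_le hbd (mem_image_of_mem g hz)]⟩
  choose next hnext hmin using step
  obtain ⟨x, hxS, hx0, hsucc, hmin'⟩ : ∃ x : ℕ → α, (∀ n, x n ∈ S) ∧ x 0 = w ∧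
      (∀ n, x (n + 1) ∈ A (x n)) ∧
      ∀ n, ∀ z ∈ A (x n), g (x (n + 1)) ≤ g z + (1 / 2 : ℝ) ^ n := by
    let y : ℕ → S := fun n => Nat.rec ⟨w, hw⟩ (fun k v => next k v) n
    exact ⟨fun n => (y n).1, fun n => (y n).2, rfl, fun n => hnext n (y n), fun n => hmin n (y n)⟩
  have hmem : ∀ n k, x (n + k) ∈ A (x n) := by
    intro n k
    induction k with
    | zero => exact self_mem _ (hxS n)
    | succ k ih => exact trans_mem _ _ _ ih (hsucc (n + k))
  have hanti : Antitone fun n => g (x n) := antitone_nat_of_succ_le fun n => by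
    nlinarith [(hsucc n).2, dist_nonneg (x := x (n + 1)) (y := x n)]
  have hbdd : BddBelow (range fun n => g (x n)) :=
    ⟨m, by rintro _ ⟨n, rfl⟩; exact hm _ (hxS n)⟩
  have hlim := tendsto_atTop_ciInf hanti hbdd
  set L := ⨅ n, g (x n)
  have hcauchy : CauchySeq x := by
    refine cauchySeq_of_le_tendsto_0' (fun n => (g (x n) - L) / κ) (fun n k hnk => ?_) ?_
    · obtain ⟨j, rfl⟩ := Nat.exists_eq_add_of_le hnk
      rw [le_div_iff₀ hκ, dist_comm]
      linarith [(hmem n j).2, ciInf_le hbdd (n + j)]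
    · simpa using (hlim.sub_const L).div_const κ
  obtain ⟨u, hu⟩ := cauchySeq_tendsto_of_complete hcauchy
  have huS : u ∈ S := hS.mem_of_tendsto hu (Eventually.of_forall hxS)
  have huA : ∀ n, u ∈ A (x n) := by
    intro n
    refine ⟨huS, ?_⟩
    have h1 : Tendsto (fun k => g (x (k + n)) + κ * dist (x (k + n)) (x n)) atTop
        (𝓝 (g u + κ * dist u (x n))) :=
      (Tendsto.add (hg.continuousAt.tendsto.comp hu)
        ((hu.dist tendsto_const_nhds).const_mul κ)).comp (tendsto_add_atTop_nat n)
    refine le_of_tendsto h1 (Eventually.of_forall fun k => ?_)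
    rw [add_comm k n]
    exact (hmem n k).2
  refine ⟨u, huS, hx0 ▸ (huA 0).2, fun z hz => ?_⟩
  by_contra! hlt
  have hzA : ∀ n, z ∈ A (x n) := fun n => trans_mem _ _ _ (huA n) ⟨hz, hlt.le⟩
  have h1 : Tendsto (fun n => g (x (n + 1))) atTop (𝓝 (g u)) :=
    (hg.continuousAt.tendsto.comp hu).comp (tendsto_add_atTop_nat 1)
  have h2 : Tendsto (fun n : ℕ => g z + (1 / 2 : ℝ) ^ n) atTop (𝓝 (g z + 0)) :=
    (tendsto_pow_atTop_nhds_zero_of_lt_one (by norm_num) (by norm_num)).const_add _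
  have h3 := le_of_tendsto_of_tendsto' h1 h2 fun n => hmin' n z (hzA n)
  nlinarith [dist_nonneg (x := z) (y := u)]

section MinimalTime

variable [NormedAddCommGroup X] [NormedSpace ℝ X] {Ω F : Set X}

theorem mtime_le {x q : X} {t : ℝ} (ht : 0 ≤ t) (hq : q ∈ F) (h : x + t • q ∈ Ω) :
    mtime Ω F x ≤ ENNReal.ofReal t :=
  iInf₂_le t ⟨ht, q, hq, h⟩

theorem mtime_eq_zero (hF : F.Nonempty) {x : X} (hx : x ∈ Ω) : mtime Ω F x = 0 := by
  obtain ⟨q, hq⟩ := hF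
  simpa using mtime_le (t := 0) le_rfl hq (by simpa using hx)

theorem exists_lt_of_mtime_ne_top {x : X} (hx : mtime Ω F x ≠ ⊤) {ν : ℝ} (hν : 0 < ν) :
    ∃ t, 0 ≤ t ∧ t < (mtime Ω F x).toReal + ν ∧ ∃ q ∈ F, x + t • q ∈ Ω := by
  have h : mtime Ω F x < ENNReal.ofReal ((mtime Ω F x).toReal + ν) := by
    rw [← ENNReal.ofReal_toReal hx, ENNReal.ofReal_lt_ofReal_iff (by positivity)]
    simpa using hν
  conv_lhs at h => rw [mtime]
  simp only [iInf_lt_iff] at h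
  obtain ⟨t, ⟨ht, q, hq, hmem⟩, hlt⟩ := h
  exact ⟨t, ht, (ENNReal.ofReal_lt_ofReal_iff (by positivity)).1 hlt, q, hq, hmem⟩

/-- The defining inequality of an `ε`-subgradient of the minimal time function, tested against an
arbitrary admissible time. -/
theorem fsub_mtime_le {ε : ℝ} {x : X} {p : X →L[ℝ] ℝ} (hp : p ∈ fsub (mtime Ω F) ε x)
    {γ : ℝ} (hγ : 0 < γ) : ∃ δ > 0, ∀ y q : X, ∀ t : ℝ, ‖y - x‖ < δ → 0 ≤ t → q ∈ F →
      y + t • q ∈ Ω → (mtime Ω F x).toReal + p (y - x) - (ε + γ) * ‖y - x‖ ≤ t := by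
  obtain ⟨δ, hδ, h⟩ := hp γ hγ
  exact ⟨δ, hδ, fun y q t hy ht hq hmem =>
    (ENNReal.ofReal_le_ofReal_iff ht).1 ((h y hy).trans (mtime_le ht hq hmem))⟩

/-- Subgradients of the minimal time function are almost bounded below on the dynamics. -/
theorem neg_apply_le_of_mem_fsub_mtime (hF : Convex ℝ F) {ε : ℝ} {x : X} {p : X →L[ℝ] ℝ}
    (hx : mtime Ω F x ≠ ⊤) (hp : p ∈ fsub (mtime Ω F) ε x) {v : X} (hv : v ∈ F) :
    -p v ≤ 1 + (ε + 1) * ‖v‖ := by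
  obtain ⟨δ, hδ, h⟩ := fsub_mtime_le hp one_pos
  obtain ⟨s, hs, hsδ⟩ : ∃ s > 0, s * ‖v‖ < δ := by
    refine ⟨δ / (‖v‖ + 1), by positivity, ?_⟩
    rw [div_mul_eq_mul_div, div_lt_iff₀ (by positivity)]
    nlinarith
  have hnorm : ‖x - s • v - x‖ = s * ‖v‖ := by
    rw [sub_sub_cancel_left, norm_neg, norm_smul, Real.norm_of_nonneg hs.le]
  have key : s * -p v ≤ s * (1 + (ε + 1) * ‖v‖) := by
    refine le_of_forall_pos_le_add fun ν hν => ?_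
    obtain ⟨t, ht, htν, q, hq, hmem⟩ := exists_lt_of_mtime_ne_top hx hν
    have hst : 0 < t + s := by positivity
    have hq' : (t / (t + s)) • q + (s / (t + s)) • v ∈ F :=
      hF hq hv (by positivity) (by positivity) (by field_simp)
    have hmem' : x - s • v + (t + s) • ((t / (t + s)) • q + (s / (t + s)) • v) ∈ Ω := by
      convert hmem using 1
      rw [smul_add, smul_smul, smul_smul, mul_div_cancel₀ _ hst.ne', mul_div_cancel₀ _ hst.ne']
      abel
    have := h _ _ _ (by rwa [hnorm]) hst.le hq' hmem'
    rw [hnorm, sub_sub_cancel_left, map_neg, map_smul, smul_eq_mul] at this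
    linarith
  exact le_of_mul_le_mul_left key hs

/-- A Fréchet `ε`-subgradient of the minimal time function at `x` is an approximate normal to the
target at a point whose distance to `x` is controlled by the minimal time. -/
theorem exists_mem_enormal_of_mem_fsub_mtime [CompleteSpace X] (hΩ : IsClosed Ω) {M : ℝ}
    (hM : ∀ q ∈ F, ‖q‖ ≤ M) {ε : ℝ} (hε : 0 ≤ ε) {x : X} {p : X →L[ℝ] ℝ}
    (hx : mtime Ω F x ≠ ⊤) (hp : p ∈ fsub (mtime Ω F) ε x) {η : ℝ} (hη : 0 < η) :
    ∃ u ∈ Ω, p ∈ enormal Ω (ε + η) u ∧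
      ‖u - x‖ ≤ η + ((mtime Ω F x).toReal + η) * M := by
  obtain ⟨δ, hδ, h⟩ := fsub_mtime_le hp (half_pos hη)
  set r := min η (δ / 4)
  have hr0 : 0 < r := lt_min hη (by positivity)
  have hrη : r ≤ η := min_le_left _ _
  have hrδ : r ≤ δ / 4 := min_le_right _ _
  obtain ⟨t, ht, htν, q, hq, hmem⟩ := exists_lt_of_mtime_ne_top hx
    (lt_min hη (by positivity) : 0 < min η (η / 2 * r))
  have htη := htν.trans_le (add_le_add_right (min_le_left _ _) _)
  have htr := htν.trans_le (add_le_add_right (min_le_right _ _) _)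
  set w := x + t • q with hw
  have happrox : ∀ z ∈ Ω ∩ Metric.closedBall w (δ / 2),
      -(η / 2 * r) ≤ -p (z - w) + (ε + η / 2) * ‖z - w‖ := by
    rintro z ⟨hz, hzw⟩
    rw [Metric.mem_closedBall, dist_eq_norm] at hzw
    have hzx : z - t • q - x = z - w := by rw [hw]; abel
    have := h (z - t • q) q t (by rw [hzx]; linarith) ht hq (by simpa using hz)
    rw [hzx] at this
    linarith
  obtain ⟨u, huS, huw, hu⟩ := exists_ekeland
    (g := fun z => -p (z - w) + (ε + η / 2) * ‖z - w‖)
    (hΩ.inter Metric.isClosed_closedBall) (by fun_prop) happrox (half_pos hη)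
    ⟨hmem, Metric.mem_closedBall_self (by positivity)⟩
  simp only [sub_self, map_zero, norm_zero, mul_zero, neg_zero, add_zero, dist_eq_norm] at huw hu
  have hur : ‖u - w‖ ≤ r := by
    have : η / 2 * ‖u - w‖ ≤ η / 2 * r := by linarith [happrox u huS]
    exact le_of_mul_le_mul_left this (half_pos hη)
  refine ⟨u, huS.1, fun γ hγ => ⟨δ / 4, by positivity, fun z hz hzu => ?_⟩, ?_⟩
  · have htri : ‖z - w‖ ≤ ‖z - u‖ + ‖u - w‖ := norm_sub_le_norm_sub_add_norm_sub z u w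
    have h1 := hu z ⟨hz, by rw [Metric.mem_closedBall, dist_eq_norm]; linarith⟩
    have h2 : p (z - u) = p (z - w) - p (u - w) := by rw [← map_sub, sub_sub_sub_cancel_right]
    have h3 := mul_le_mul_of_nonneg_left htri (by positivity : 0 ≤ ε + η / 2)
    have h4 : 0 ≤ γ * ‖z - u‖ := by positivity
    rw [h2]
    linarith
  · have h1 : ‖w - x‖ = t * ‖q‖ := by
      rw [hw, add_sub_cancel_left, norm_smul, Real.norm_of_nonneg ht]
    have h2 : t * ‖q‖ ≤ ((mtime Ω F x).toReal + η) * M :=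
      mul_le_mul htη.le (hM q hq) (norm_nonneg q) (by positivity)
    linarith [norm_sub_le_norm_sub_add_norm_sub u w x]

theorem smul_mem_enormal {ε c : ℝ} (hc : 0 < c) {u : X} {p : X →L[ℝ] ℝ}
    (hp : p ∈ enormal Ω ε u) : c • p ∈ enormal Ω (c * ε) u := by
  intro γ hγ
  obtain ⟨δ, hδ, h⟩ := hp (γ / c) (by positivity)
  refine ⟨δ, hδ, fun z hz hzu => ?_⟩
  calc (c • p) (z - u) = c * p (z - u) := rfl
    _ ≤ c * ((ε + γ / c) * ‖z - u‖) := mul_le_mul_of_nonneg_left (h z hz hzu) hc.le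
    _ = (c * ε + γ) * ‖z - u‖ := by field_simp

theorem apply_le_suppFn (hF : Bornology.IsBounded F) (p : X →L[ℝ] ℝ) {q : X} (hq : q ∈ F) :
    p q ≤ suppFn F p :=
  le_csSup (p.lipschitz.isBounded_image hF).bddAbove (mem_image_of_mem _ hq)

/-- An `ε`-normal to the target becomes, after scaling by a factor dominating the support function,
a Fréchet subgradient of the minimal time function. -/
theorem inv_smul_mem_fsub_mtime (hFb : Bornology.IsBounded F) (hFne : F.Nonempty) {M : ℝ}
    (hM : ∀ q ∈ F, ‖q‖ ≤ M) {ε lam : ℝ} (hε : 0 ≤ ε) {u : X} {p : X →L[ℝ] ℝ}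
    (hu : u ∈ Ω) (hp : p ∈ enormal Ω ε u) (hlam0 : 0 < lam)
    (hlam : suppFn F (-p) + ε * M < lam) :
    lam⁻¹ • p ∈ fsub (mtime Ω F) (ε / lam) u := by
  have hM0 : 0 ≤ M := hFne.elim fun q hq => (norm_nonneg q).trans (hM q hq)
  intro γ hγ
  obtain ⟨γ', hγ'0, hγ'γ, hγ'M⟩ : ∃ γ' > 0, γ' ≤ lam * γ ∧
      suppFn F (-p) + (ε + γ') * M ≤ lam := by
    refine ⟨min (lam * γ) ((lam - (suppFn F (-p) + ε * M)) / (M + 1)),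
      lt_min (by positivity) (div_pos (by linarith) (by positivity)), min_le_left _ _, ?_⟩
    have h1 := min_le_right (lam * γ) ((lam - (suppFn F (-p) + ε * M)) / (M + 1))
    rw [le_div_iff₀ (by positivity)] at h1
    have h2 : 0 < min (lam * γ) ((lam - (suppFn F (-p) + ε * M)) / (M + 1)) :=
      lt_min (by positivity) (div_pos (by linarith) (by positivity))
    linarith
  obtain ⟨δ, hδ, h⟩ := hp γ' hγ'0
  refine ⟨δ / (1 + ‖p‖ / lam * M), by positivity, fun y hy => ?_⟩
  rw [mtime_eq_zero hFne hu, mtime]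
  refine le_iInf₂ fun t ⟨ht, q, hq, hmem⟩ => ENNReal.ofReal_le_ofReal ?_
  suffices hmain : p (y - u) ≤ lam * t + (ε + lam * γ) * ‖y - u‖ by
    refine le_of_mul_le_mul_left ?_ hlam0
    have : lam * ((0 : ℝ≥0∞).toReal + (lam⁻¹ • p) (y - u) - (ε / lam + γ) * ‖y - u‖)
        = p (y - u) - (ε + lam * γ) * ‖y - u‖ := by
      simp only [ENNReal.toReal_zero, smul_apply, smul_eq_mul]
      field_simp
      ring
    linarith
  rw [lt_div_iff₀ (by positivity)] at hy
  rcases le_total (‖p‖ * ‖y - u‖) (lam * t) with hlarge | hsmall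
  · have h1 : 0 ≤ (ε + lam * γ) * ‖y - u‖ := by positivity
    linarith [(le_abs_self _).trans (p.le_opNorm (y - u))]
  · have hsmall' : t ≤ ‖p‖ / lam * ‖y - u‖ := by
      rw [div_mul_eq_mul_div, le_div_iff₀ hlam0]
      linarith
    have hsplit : y + t • q - u = (y - u) + t • q := by abel
    have hnorm : ‖y + t • q - u‖ ≤ ‖y - u‖ + t * M := by
      rw [hsplit]
      refine (norm_add_le _ _).trans ?_
      rw [norm_smul, Real.norm_of_nonneg ht]
      gcongr
      exact hM q hq
    have h1 := h _ hmem (by nlinarith)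
    have h2 : p (y + t • q - u) = p (y - u) + t * p q := by
      rw [hsplit, map_add, map_smul, smul_eq_mul]
    have h3 : t * -p q ≤ t * suppFn F (-p) :=
      mul_le_mul_of_nonneg_left (apply_le_suppFn hFb (-p) hq) ht
    have h4 := mul_le_mul_of_nonneg_left hnorm (by positivity : 0 ≤ ε + γ')
    have h5 := mul_le_mul_of_nonneg_left hγ'M ht
    have h6 := mul_le_mul_of_nonneg_right hγ'γ (norm_nonneg (y - u))
    linarith

theorem ssub_mtime_subset [CompleteSpace X] (hΩ : IsClosed Ω) (hFne : F.Nonempty)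
    (hFb : Bornology.IsBounded F) (hF : Convex ℝ F) {xb : X} (hxb : xb ∈ Ω) :
    ssub (mtime Ω F) xb ⊆ bnormal Ω xb ∩ {p | ∀ v ∈ F, 0 ≤ p v} := by
  rintro p ⟨ε, lam, x, ps, hε, hε0, hlam, hlam0, hx, hTx, hps, hlim⟩
  rw [mtime_eq_zero hFne hxb] at hTx
  obtain ⟨M, hM⟩ := hFb.exists_norm_le
  have hfin : ∀ᶠ k in atTop, mtime Ω F (x k) ≠ ⊤ :=
    (hTx.eventually_lt_const ENNReal.zero_lt_top).mono fun k hk => hk.ne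
  constructor
  · obtain ⟨N, hN⟩ := eventually_atTop.1 hfin
    have hN' : ∀ k, mtime Ω F (x (k + N)) ≠ ⊤ := fun k => hN _ (Nat.le_add_left N k)
    have hshift := tendsto_add_atTop_nat N
    have hη : Tendsto (fun k : ℕ => 1 / ((k : ℝ) + 1)) atTop (𝓝 0) :=
      tendsto_one_div_add_atTop_nhds_zero_nat
    have hT : Tendsto (fun k => (mtime Ω F (x (k + N))).toReal) atTop (𝓝 0) := by
      simpa [Function.comp_def] using (ENNReal.tendsto_toReal ENNReal.zero_ne_top).comp (hTx.comp hshift)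
    choose u huΩ hu hux using fun k : ℕ => exists_mem_enormal_of_mem_fsub_mtime hΩ hM
      (hε (k + N)) (hN' k) (hps (k + N)) (Nat.one_div_pos_of_nat : 0 < 1 / ((k : ℝ) + 1))
    have hdist : Tendsto (fun k => u k - x (k + N)) atTop (𝓝 0) := by
      refine squeeze_zero_norm hux ?_
      simpa using hη.add ((hT.add hη).mul_const M)
    refine ⟨fun k => lam (k + N) * (ε (k + N) + 1 / ((k : ℝ) + 1)), u,
      fun k => lam (k + N) • ps (k + N), fun k => ?_, ?_, huΩ, ?_,
      fun k => smul_mem_enormal (hlam _) (hu k), fun v => (hlim v).comp hshift⟩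
    · have := hε (k + N)
      have := hlam (k + N)
      positivity
    · simpa using (hlam0.comp hshift).mul ((hε0.comp hshift).add hη)
    · simpa using hdist.add (hx.comp hshift)
  · intro v hv
    have h1 : Tendsto (fun k => -(lam k * (1 + (ε k + 1) * ‖v‖))) atTop (𝓝 0) := by
      simpa using (hlam0.mul (((hε0.add_const 1).mul_const ‖v‖).const_add 1)).neg
    refine le_of_tendsto_of_tendsto h1 (hlim v) (hfin.mono fun k hk => ?_)
    have := mul_le_mul_of_nonneg_left
      (neg_apply_le_of_mem_fsub_mtime hF hk (hps k) hv) (hlam k).le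
    simp only
    linarith

theorem mem_ssub_mtime_of_tendsto_suppFn (hFb : Bornology.IsBounded F) (h0 : (0 : X) ∈ F)
    {xb : X} (hxb : xb ∈ Ω) {p : X →L[ℝ] ℝ} (hp : p ∈ bnormal Ω xb) (hpF : ∀ v ∈ F, 0 ≤ p v)
    (hcont : ∀ u : ℕ → X →L[ℝ] ℝ, (∀ v, Tendsto (fun k => u k v) atTop (𝓝 ((-p) v))) →
      Tendsto (fun k => suppFn F (u k)) atTop (𝓝 (suppFn F (-p)))) :
    p ∈ ssub (mtime Ω F) xb := by
  obtain ⟨ε, x, ps, hε, hε0, hxΩ, hx, hps, hlim⟩ := hp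
  have hFne : F.Nonempty := ⟨0, h0⟩
  obtain ⟨M, hM⟩ := hFb.exists_norm_le
  have hM0 : 0 ≤ M := by simpa using hM 0 h0
  have hσ_nonneg : ∀ f : X →L[ℝ] ℝ, 0 ≤ suppFn F f := fun f => by
    simpa using apply_le_suppFn hFb f h0
  have hσp : suppFn F (-p) = 0 := by
    refine le_antisymm (csSup_le (hFne.image _) ?_) (hσ_nonneg _)
    rintro _ ⟨q, hq, rfl⟩
    simpa using hpF q hq
  have hσ := hcont (fun k => -ps k) fun v => (hlim v).neg
  rw [hσp] at hσ
  have hη : Tendsto (fun k : ℕ => 1 / ((k : ℝ) + 1)) atTop (𝓝 0) :=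
    tendsto_one_div_add_atTop_nhds_zero_nat
  have hsqrt : Tendsto (fun k => √(ε k)) atTop (𝓝 0) := by
    simpa [Function.comp_def] using (Real.continuous_sqrt.tendsto 0).comp hε0
  set lam : ℕ → ℝ := fun k => suppFn F (-ps k) + ε k * M + √(ε k) + 1 / ((k : ℝ) + 1) with hlam
  have hη_pos : ∀ k : ℕ, 0 < 1 / ((k : ℝ) + 1) := fun k => Nat.one_div_pos_of_nat
  have hεM : ∀ k, 0 ≤ ε k * M := fun k => mul_nonneg (hε k) hM0
  have hlam_pos : ∀ k, 0 < lam k := fun k => by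
    simp only [hlam]
    linarith [hσ_nonneg (-ps k), hεM k, Real.sqrt_nonneg (ε k), hη_pos k]
  refine ⟨fun k => ε k / lam k, lam, x, fun k => (lam k)⁻¹ • ps k,
    fun k => div_nonneg (hε k) (hlam_pos k).le, ?_, hlam_pos, ?_, hx, ?_, fun k => ?_,
    fun v => ?_⟩
  · refine squeeze_zero (fun k => div_nonneg (hε k) (hlam_pos k).le) (fun k => ?_) hsqrt
    rw [div_le_iff₀ (hlam_pos k)]
    have h1 : √(ε k) ≤ lam k := by
      simp only [hlam]
      linarith [hσ_nonneg (-ps k), hεM k, hη_pos k]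
    calc ε k = √(ε k) * √(ε k) := (Real.mul_self_sqrt (hε k)).symm
      _ ≤ √(ε k) * lam k := mul_le_mul_of_nonneg_left h1 (Real.sqrt_nonneg _)
  · simpa [hlam] using ((hσ.add (hε0.mul_const M)).add hsqrt).add hη
  · simp only [mtime_eq_zero hFne hxb, mtime_eq_zero hFne (hxΩ _), tendsto_const_nhds]
  · refine inv_smul_mem_fsub_mtime hFb hFne hM (hε k) (hxΩ k) (hps k) (hlam_pos k) ?_
    simp only [hlam]
    linarith [Real.sqrt_nonneg (ε k), hη_pos k]
  · refine (hlim v).congr fun k => ?_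
    simp [mul_inv_cancel_left₀ (hlam_pos k).ne']

end MinimalTime

/-- Theorem 5.3: singular subgradients of minimal time functions via basic
normals to targets at in-set points: `∂^∞T(x̄) ⊆ N(x̄; Ω) ∩ F*₊`, with equality
when `0 ∈ F` and `σ_F` is sequentially weak* continuous on `−[N(x̄;Ω) ∩ F*₊]`. -/
theorem ssub_mtime_inset [NormedAddCommGroup X] [NormedSpace ℝ X]
    [CompleteSpace X]
    (Ω F : Set X) (hΩne : Ω.Nonempty) (hΩcl : IsClosed Ω)
    (hFne : F.Nonempty) (hFcl : IsClosed F) (hFbd : Bornology.IsBounded F)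
    (hFcv : Convex ℝ F)
    (xb : X) (hxb : xb ∈ Ω) :
    (ssub (mtime Ω F) xb ⊆ bnormal Ω xb ∩ {p | ∀ v ∈ F, 0 ≤ p v}) ∧
    (0 ∈ F →
      (∀ p ∈ bnormal Ω xb ∩ {p | ∀ v ∈ F, 0 ≤ p v},
        ∀ u : ℕ → X →L[ℝ] ℝ,
          (∀ v, Tendsto (fun k => u k v) atTop (𝓝 ((-p) v))) →
          Tendsto (fun k => suppFn F (u k)) atTop (𝓝 (suppFn F (-p)))) →
      ssub (mtime Ω F) xb = bnormal Ω xb ∩ {p | ∀ v ∈ F, 0 ≤ p v}) := by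
  have hsub := ssub_mtime_subset hΩcl hFne hFbd hFcv hxb
  exact ⟨hsub, fun h0 hcont => hsub.antisymm fun p hp =>
    mem_ssub_mtime_of_tendsto_suppFn hFbd h0 hxb hp.1 hp.2 (hcont p hp)⟩
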